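/- arXiv:1801.08814 — 2 statements merged into one kernel-verified Lean document; each statement's English description precedes it below -/
import Mathlib

section
/- Every nonsingular coloring λ : V → (ℤ/2)⁴ \ {0} of the facet-adjacency graph G of the 120-cell whose range has cardinality 5 is GL₄(ℤ/2)-equivalent to a coloring whose range is one of the three sets {e₁,e₂,e₃,e₄, e₁+e₂}, {e₁,e₂,e₃,e₄, e₁+e₂+e₃}, {e₁,e₂,e₃,e₄, e₁+e₂+e₃+e₄}; that is, there exists g ∈ GL₄(ℤ/2) such that the range of g∘λ is one of these three sets, where e₁,…,e₄ is the standard basis of (ℤ/2)⁴. -/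
open Quaternion

noncomputable section

/-- The golden ratio. -/
def gold : ℝ := (1 + Real.sqrt 5) / 2

/-- The coordinates of a quaternion, viewed as a vector in `ℝ⁴`. -/
def qcoords (q : ℍ[ℝ]) : Fin 4 → ℝ := ![q.re, q.imI, q.imJ, q.imK]

/-- The standard inner product of two quaternions viewed as vectors in `ℝ⁴`. -/
def qinner (p q : ℍ[ℝ]) : ℝ := ∑ i, qcoords p i * qcoords q i

/-- A choice of signs. -/
def IsSign (s : Fin 4 → ℝ) : Prop := ∀ i, s i = 1 ∨ s i = -1

/-- The coordinate multiset `(0, 1, φ⁻¹, φ)`. -/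
def baseVec : Fin 4 → ℝ := ![0, 1, gold⁻¹, gold]

/-- The 120 facet centers of the right-angled 120-cell: the 24 Hurwitz units
`±1, ±i, ±j, ±k, (±1±i±j±k)/2` together with the 96 quaternions obtained from
`(0 ± i ± φ⁻¹j ± φk)/2` by even permutations of the coordinates `(0,1,φ⁻¹,φ)`
and all choices of signs. -/
def Vcell : Set ℍ[ℝ] :=
  {q | (∃ s : Fin 4 → ℝ, IsSign s ∧
          ((∃ i : Fin 4, ∀ j, qcoords q j = if j = i then s i else 0) ∨
           (∀ j, qcoords q j = s j / 2))) ∨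
       (∃ σ : Equiv.Perm (Fin 4), σ ∈ alternatingGroup (Fin 4) ∧
          ∃ s : Fin 4 → ℝ, IsSign s ∧ ∀ j, qcoords q j = s j * baseVec (σ j) / 2)}

/-- Facet adjacency in the 120-cell: two facet centers are adjacent iff their
inner product equals `φ/2 = cos (π/5)`. -/
def Adj (p q : ℍ[ℝ]) : Prop := p ∈ Vcell ∧ q ∈ Vcell ∧ qinner p q = gold / 2

/-- A nonsingular coloring (characteristic function) of the 120-cell: facets get
nonzero colors in `(ℤ/2)⁴` and any four pairwise adjacent facets get a basis. -/
def Nonsingular (lam : ℍ[ℝ] → (Fin 4 → ZMod 2)) : Prop :=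
  (∀ q ∈ Vcell, lam q ≠ 0) ∧
  ∀ a b c d : ℍ[ℝ], Adj a b → Adj a c → Adj a d → Adj b c → Adj b d → Adj c d →
    LinearIndependent (ZMod 2) ![lam a, lam b, lam c, lam d]

/-- The symmetry group of the 120-cell, realized as the permutations of `Vcell`
of the form `x ↦ pxq` or `x ↦ p x̄ q` with `p, q ∈ Vcell`. -/
def SymE : Set (ℍ[ℝ] → ℍ[ℝ]) :=
  {f | ∃ p ∈ Vcell, ∃ q ∈ Vcell,
        (f = fun x => p * x * q) ∨ (f = fun x => p * star x * q)}

/-- DJ-equivalence of colorings: `λ = g ∘ μ ∘ a` on the facets, for some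
`g ∈ GL₄(ℤ/2)` and some symmetry `a` of the 120-cell. -/
def DJEquiv (lam mu : ℍ[ℝ] → (Fin 4 → ZMod 2)) : Prop :=
  ∃ g : (Fin 4 → ZMod 2) ≃ₗ[ZMod 2] (Fin 4 → ZMod 2),
    ∃ a ∈ SymE, ∀ x ∈ Vcell, lam x = g (mu (a x))

/-- Orientability (Nakayama–Nishimura): after a change of basis every color has
odd weight. -/
def OrientableColoring (lam : ℍ[ℝ] → (Fin 4 → ZMod 2)) : Prop :=
  ∃ g : (Fin 4 → ZMod 2) ≃ₗ[ZMod 2] (Fin 4 → ZMod 2),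
    ∀ x ∈ Vcell, ∑ i, g (lam x) i = 1


/-- The standard basis of `(ℤ/2)⁴`. -/
def e (i : Fin 4) : Fin 4 → ZMod 2 := Pi.single i 1

lemma gold_sq : gold * gold = gold + 1 := by
  have h : Real.sqrt 5 * Real.sqrt 5 = 5 := Real.mul_self_sqrt (by norm_num)
  unfold gold; nlinarith

lemma gold_inv : gold⁻¹ = gold - 1 := by
  have h := gold_sq
  have h0 : gold ≠ 0 := by intro h0; rw [h0] at h; norm_num at h
  field_simp
  linarith

/-- The three neighbours of `1` which, with `1`, form a clique. -/
def qA : ℍ[ℝ] := ⟨gold / 2, 0, gold⁻¹ / 2, 1 / 2⟩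
def qB : ℍ[ℝ] := ⟨gold / 2, 1 / 2, 0, gold⁻¹ / 2⟩
def qC : ℍ[ℝ] := ⟨gold / 2, gold⁻¹ / 2, 1 / 2, 0⟩
def qO : ℍ[ℝ] := ⟨1, 0, 0, 0⟩

lemma qO_mem : qO ∈ Vcell := by
  refine Or.inl ⟨fun _ => 1, fun _ => Or.inl rfl, Or.inl ⟨0, ?_⟩⟩
  intro j; fin_cases j <;> simp [qcoords, qO]

lemma mem_of_perm (q : ℍ[ℝ]) (σ : Equiv.Perm (Fin 4)) (hσ : Equiv.Perm.sign σ = 1)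
    (h : ∀ j, qcoords q j = baseVec (σ j) / 2) : q ∈ Vcell :=
  Or.inr ⟨σ, Equiv.Perm.mem_alternatingGroup.2 hσ, fun _ => 1, fun _ => Or.inl rfl,
    fun j => by rw [h j, one_mul]⟩

lemma qA_mem : qA ∈ Vcell := by
  refine mem_of_perm _ ⟨![3, 0, 2, 1], ![1, 3, 2, 0], by decide, by decide⟩ (by decide) ?_
  intro j; fin_cases j <;> simp [qcoords, qA, baseVec]

lemma qB_mem : qB ∈ Vcell := by
  refine mem_of_perm _ ⟨![3, 1, 0, 2], ![2, 1, 3, 0], by decide, by decide⟩ (by decide) ?_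
  intro j; fin_cases j <;> simp [qcoords, qB, baseVec]

lemma qC_mem : qC ∈ Vcell := by
  refine mem_of_perm _ ⟨![3, 2, 1, 0], ![3, 2, 1, 0], by decide, by decide⟩ (by decide) ?_
  intro j; fin_cases j <;> simp [qcoords, qC, baseVec]

lemma clique_indep (lam : ℍ[ℝ] → (Fin 4 → ZMod 2)) (h : Nonsingular lam) :
    LinearIndependent (ZMod 2) ![lam qO, lam qA, lam qB, lam qC] := by
  have g := gold_sq
  apply h.2
  · exact ⟨qO_mem, qA_mem, by simp [qinner, qcoords, Fin.sum_univ_four, qO, qA]⟩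
  · exact ⟨qO_mem, qB_mem, by simp [qinner, qcoords, Fin.sum_univ_four, qO, qB]⟩
  · exact ⟨qO_mem, qC_mem, by simp [qinner, qcoords, Fin.sum_univ_four, qO, qC]⟩
  · exact ⟨qA_mem, qB_mem, by
      simp [qinner, qcoords, Fin.sum_univ_four, qB, qA, gold_inv]; nlinarith⟩
  · exact ⟨qA_mem, qC_mem, by
      simp [qinner, qcoords, Fin.sum_univ_four, qC, qA, gold_inv]; nlinarith⟩
  · exact ⟨qB_mem, qC_mem, by
      simp [qinner, qcoords, Fin.sum_univ_four, qB, qC, gold_inv]; nlinarith⟩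

/-- Up to a permutation of the coordinates, a fifth nonzero vector is one of three. -/
lemma perm_normalize : ∀ v : Fin 4 → ZMod 2, v ≠ 0 → (∀ i, v ≠ e i) →
    ∃ σ : Equiv.Perm (Fin 4),
      v ∘ σ = e 0 + e 1 ∨ v ∘ σ = e 0 + e 1 + e 2 ∨ v ∘ σ = e 0 + e 1 + e 2 + e 3 := by
  unfold e
  decide +kernel

lemma perm_basis : ∀ σ : Equiv.Perm (Fin 4),
    ({e 0 ∘ σ, e 1 ∘ σ, e 2 ∘ σ, e 3 ∘ σ} : Finset (Fin 4 → ZMod 2)) = {e 0, e 1, e 2, e 3} := by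
  unfold e
  decide +kernel

lemma basis_card : ({e 0, e 1, e 2, e 3} : Finset (Fin 4 → ZMod 2)).card = 4 := by
  unfold e
  decide +kernel

lemma set_normalize (S : Set (Fin 4 → ZMod 2)) (h0 : (0 : Fin 4 → ZMod 2) ∉ S)
    (he : ∀ i, e i ∈ S) (hc : S.ncard = 5) :
    ∃ σ : Equiv.Perm (Fin 4),
      (fun v : Fin 4 → ZMod 2 => v ∘ σ) '' S = {e 0, e 1, e 2, e 3, e 0 + e 1} ∨
      (fun v : Fin 4 → ZMod 2 => v ∘ σ) '' S = {e 0, e 1, e 2, e 3, e 0 + e 1 + e 2} ∨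
      (fun v : Fin 4 → ZMod 2 => v ∘ σ) '' S = {e 0, e 1, e 2, e 3, e 0 + e 1 + e 2 + e 3} := by
  set B : Set (Fin 4 → ZMod 2) := {e 0, e 1, e 2, e 3} with hB
  have hBF : B = (({e 0, e 1, e 2, e 3} : Finset (Fin 4 → ZMod 2)) : Set _) := by simp [hB]
  have hBc : B.ncard = 4 := by rw [hBF, Set.ncard_coe_finset, basis_card]
  have hBS : B ⊆ S := by
    rintro x (rfl | rfl | rfl | rfl) <;> exact he _
  have hd : (S \ B).ncard = 1 := by
    rw [Set.ncard_diff hBS, hc, hBc]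
  obtain ⟨v, hv⟩ := Set.ncard_eq_one.1 hd
  have hvm : v ∈ S \ B := by rw [hv]; rfl
  have hS : S = B ∪ {v} := by rw [← hv, Set.union_diff_cancel hBS]
  have hv0 : v ≠ 0 := fun h => h0 (h ▸ hvm.1)
  have hve : ∀ i, v ≠ e i := by
    intro i h
    apply hvm.2
    rw [h, hB]
    fin_cases i <;> simp
  obtain ⟨σ, hσ⟩ := perm_normalize v hv0 hve
  have hBσ : (fun v : Fin 4 → ZMod 2 => v ∘ σ) '' B = B := by
    have := congrArg (fun F : Finset (Fin 4 → ZMod 2) => (F : Set (Fin 4 → ZMod 2)))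
      (perm_basis σ)
    simp only [Finset.coe_insert, Finset.coe_singleton] at this
    rw [hB]
    simp only [Set.image_insert_eq, Set.image_singleton]
    exact this
  have key : ∀ w, v ∘ σ = w →
      (fun v : Fin 4 → ZMod 2 => v ∘ σ) '' S = {e 0, e 1, e 2, e 3, w} := by
    rintro w rfl
    rw [hS, Set.image_union, hBσ, Set.image_singleton, hB]
    ext x
    simp only [Set.mem_union, Set.mem_insert_iff, Set.mem_singleton_iff, or_assoc]
  exact ⟨σ, hσ.imp (key _) (Or.imp (key _) (key _))⟩

/-- Every nonsingular 5-coloring of the 120-cell is `GL₄(ℤ/2)`-equivalent to one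
whose range is one of the three sets `{e₁,e₂,e₃,e₄,e₁+e₂}`,
`{e₁,e₂,e₃,e₄,e₁+e₂+e₃}`, `{e₁,e₂,e₃,e₄,e₁+e₂+e₃+e₄}`. -/
theorem five_coloring_representatives :
    ∀ lam : ℍ[ℝ] → (Fin 4 → ZMod 2), Nonsingular lam →
      Set.ncard (lam '' Vcell) = 5 →
      ∃ g : (Fin 4 → ZMod 2) ≃ₗ[ZMod 2] (Fin 4 → ZMod 2),
        (fun x => g (lam x)) '' Vcell =
            ({e 0, e 1, e 2, e 3, e 0 + e 1} : Set (Fin 4 → ZMod 2)) ∨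
        (fun x => g (lam x)) '' Vcell =
            ({e 0, e 1, e 2, e 3, e 0 + e 1 + e 2} : Set (Fin 4 → ZMod 2)) ∨
        (fun x => g (lam x)) '' Vcell =
            ({e 0, e 1, e 2, e 3, e 0 + e 1 + e 2 + e 3} : Set (Fin 4 → ZMod 2)) := by
  intro lam hns hcard
  have hli := clique_indep lam hns
  let b := basisOfLinearIndependentOfCardEqFinrank hli (by simp)
  have hb : ∀ i, b i = ![lam qO, lam qA, lam qB, lam qC] i := by
    intro i; simp [b]
  let g₀ : (Fin 4 → ZMod 2) ≃ₗ[ZMod 2] (Fin 4 → ZMod 2) := b.equivFun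
  have hg : ∀ i, g₀ (![lam qO, lam qA, lam qB, lam qC] i) = e i := by
    intro i
    rw [← hb i]
    funext j
    simp [g₀, e, Pi.single_apply, Finsupp.single_apply, eq_comm]
  have hS := set_normalize (g₀ '' (lam '' Vcell)) ?_ ?_ ?_
  · obtain ⟨σ, hσ⟩ := hS
    refine ⟨g₀.trans (LinearEquiv.funCongrLeft (ZMod 2) (ZMod 2) σ), ?_⟩
    rw [Set.image_image, Set.image_image] at hσ
    exact hσ
  · rintro ⟨_, ⟨q, hq, rfl⟩, h⟩
    exact hns.1 q hq (by simpa using h)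
  · intro i
    rw [← hg i]
    apply Set.mem_image_of_mem
    fin_cases i
    · exact ⟨qO, qO_mem, rfl⟩
    · exact ⟨qA, qA_mem, rfl⟩
    · exact ⟨qB, qB_mem, rfl⟩
    · exact ⟨qC, qC_mem, rfl⟩
  · rw [Set.ncard_image_of_injective _ g₀.injective, hcard]
end
end

section
/- For n = 2, 3, 4, the number of DJ-equivalence classes of nonsingular (ℤ/2)ⁿ-colorings of the facets of the n-dimensional cube Iⁿ is respectively 2, 5, and 19. -/
/-- A nonsingular `(ℤ/2)ⁿ`-coloring of the facets of the `n`-cube: facets are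
pairs `(i, s)`, a vertex `v : Fin n → Bool` lies on the facets `(i, v i)`, and
the colors of the `n` facets at each vertex must form a basis of `(ℤ/2)ⁿ`. -/
def CubeNonsingular (n : ℕ) (lam : Fin n × Bool → (Fin n → ZMod 2)) : Prop :=
  (∀ F, lam F ≠ 0) ∧
  ∀ v : Fin n → Bool, LinearIndependent (ZMod 2) (fun i => lam (i, v i))

/-- The hyperoctahedral group acting on the facets of the `n`-cube. -/
def CubeSym (n : ℕ) : Set (Equiv.Perm (Fin n × Bool)) :=
  {a | ∃ σ : Equiv.Perm (Fin n), ∃ ε : Fin n → Bool,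
    ∀ i s, a (i, s) = (σ i, Bool.xor (ε i) s)}

/-- DJ-equivalence of colorings of the `n`-cube. -/
def CubeDJEquiv (n : ℕ) (lam mu : Fin n × Bool → (Fin n → ZMod 2)) : Prop :=
  ∃ g : (Fin n → ZMod 2) ≃ₗ[ZMod 2] (Fin n → ZMod 2),
    ∃ a ∈ CubeSym n, ∀ F, lam F = g (mu (a F))

namespace CubeDJ

/-! Boolean checks, written with bare recursors so that the kernel evaluates them quickly. -/

noncomputable def andR (a b : Bool) : Bool := Bool.rec false b a

noncomputable def allR {α : Type} (p : α → Bool) (l : List α) : Bool :=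
  List.rec true (fun a _ ih => Bool.rec false ih (p a)) l

noncomputable def anyR {α : Type} (p : α → Bool) (l : List α) : Bool :=
  List.rec false (fun a _ ih => Bool.rec ih true (p a)) l

noncomputable def mapR {α β : Type} (f : α → β) (l : List α) : List β :=
  List.rec [] (fun a _ ih => f a :: ih) l

noncomputable def snocR {α : Type} (l : List α) (x : α) : List α :=
  List.rec [x] (fun a _ ih => a :: ih) l

/-- `lin P m` is the xor of those entries of `P` whose position is a set bit of `m`. -/
noncomputable def lin (P : List ℕ) : ℕ → ℕ :=
  List.rec (fun _ => nat_lit 0)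
    (fun p _ ih m => Nat.xor (Nat.mul (Nat.mod m (nat_lit 2)) p) (ih (Nat.div m (nat_lit 2)))) P

/-- Boolean equality of lists of naturals. -/
noncomputable def leq (l : List ℕ) : List ℕ → Bool :=
  List.rec (fun r => List.rec true (fun _ _ _ => false) r)
    (fun a _ ih r => List.rec false (fun b r _ => Bool.rec false (ih r) (Nat.beq a b)) r) l

/-- Componentwise membership. -/
noncomputable def inSec (l : List ℕ) : List (List ℕ) → Bool :=
  List.rec (fun r => List.rec true (fun _ _ _ => false) r)
    (fun a _ ih r => List.rec false (fun b r _ => Bool.rec false (ih r) (anyR (Nat.beq a) b)) r) l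

noncomputable def getR (l : List ℕ) : ℕ → ℕ :=
  List.rec (fun _ => nat_lit 0) (fun a _ ih j => Nat.rec a (fun j _ => ih j) j) l

/-- The code of the colour of the facet `(j, s)`. -/
noncomputable def val (B : List ℕ) (j : ℕ) (s : Bool) : ℕ :=
  Bool.rec (getR B j) (Nat.pow (nat_lit 2) j) s

/-- The codes of the images of the facets `(j, true)`. -/
noncomputable def pcol (B : List ℕ) (a : List (ℕ × Bool)) : List ℕ :=
  mapR (fun q => val B q.1 (Bool.rec true false q.2)) a

/-- The codes of the images of the facets `(j, false)`. -/
noncomputable def qcol (B : List ℕ) (a : List (ℕ × Bool)) : List ℕ :=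
  mapR (fun q => val B q.1 q.2) a

/-- The equivalence test with explicit symmetry. -/
noncomputable def chk (A B : List ℕ) (a : List (ℕ × Bool)) : Bool :=
  leq (mapR (lin (pcol B a)) A) (qcol B a)

/-- `a` codes an element of the hyperoctahedral group. -/
def valid (n : ℕ) (a : List (ℕ × Bool)) : Bool :=
  decide (a.length = n) && (decide ((a.map Prod.fst).Nodup) && (a.map Prod.fst).all fun j => decide (j < n))

noncomputable def nonsing (A : List ℕ) (l : List ℕ) : Bool :=
  allR (fun m => Bool.rec (Bool.rec true false (Nat.beq (Nat.land (lin A m) m) (nat_lit 0)))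
    true (Nat.beq m (nat_lit 0))) l

noncomputable def pack (l : List ℕ) : ℕ :=
  List.rec (nat_lit 0) (fun b _ ih => Nat.add b (Nat.mul (nat_lit 2) ih)) l

noncomputable def conj (A l : List ℕ) : List ℕ :=
  mapR (fun i => pack (mapR (fun j => Nat.mod (Nat.shiftRight (getR A i) j) (nat_lit 2)) l)) l

def tri (n : ℕ) : List (List ℕ) := (List.range n).map fun i => List.range' (2 ^ i) (2 ^ i)

noncomputable def leaf1 (n : ℕ) (A : List ℕ) : Bool :=
  anyR (fun l =>
      andR (inSec (conj A l) (tri n)) (andR (valid n (l.map fun i => (i, false)))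
        (chk (conj A l) A (l.map fun i => (i, false))))) (List.range n).permutations'

noncomputable def dfs1 (n : ℕ) (r : List ℕ) : List ℕ → Bool :=
  List.rec (fun acc => leaf1 n acc)
    (fun k _ ih acc => allR (fun c => Bool.rec true (ih (snocR acc c))
      (nonsing (snocR acc c) (List.range (2 ^ (k + 1))))) (List.range (2 ^ n))) r

/-- Search for a symmetry. -/
noncomputable def dfs2 (n : ℕ) (A B : List ℕ) (ch : List (ℕ × Bool)) (C : List ℕ) :
    List (ℕ × Bool) → Bool :=
  List.rec (fun acc => andR (valid n acc) (chk A B acc))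
    (fun c _ ih acc => anyR (fun q =>
      andR (allR (fun q' => Bool.rec true false (Nat.beq q'.1 q.1)) acc)
        (andR (Nat.beq (lin (pcol B (snocR acc q)) c) (val B q.1 q.2)) (ih (snocR acc q)))) ch) C

noncomputable def iso (n : ℕ) (ch : List (ℕ × Bool)) (A B : List ℕ) : Bool := dfs2 n A B ch A []

noncomputable def stage2 (n : ℕ) (ch : List (ℕ × Bool)) (R : List (List ℕ)) : Bool :=
  allR (fun T => anyR (fun B => iso n ch T B) R) (tri n).sections

noncomputable def pw (n : ℕ) (ch : List (ℕ × Bool)) (R : List (List ℕ)) : Bool :=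
  List.rec true (fun A R ih =>
    andR (allR (fun B => Bool.rec true false (iso n ch A B)) R) ih) R

noncomputable def good (n : ℕ) (R : List (List ℕ)) : Bool :=
  allR (fun A => andR (inSec A (tri n)) (nonsing A (List.range (2 ^ n)))) R

theorem andR_eq (a b : Bool) : andR a b = (a && b) := by cases a <;> rfl

theorem allR_iff {α : Type} (p : α → Bool) (l : List α) :
    allR p l = true ↔ ∀ x ∈ l, p x = true := by
  induction l with
  | nil => simp [allR]
  | cons a l ih =>
    have h : allR p (a :: l) = (p a && allR p l) := by
      show (Bool.rec false (allR p l) (p a) : Bool) = _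
      cases p a <;> rfl
    rw [h]; simp [ih]

theorem anyR_iff {α : Type} (p : α → Bool) (l : List α) :
    anyR p l = true ↔ ∃ x ∈ l, p x = true := by
  induction l with
  | nil => simp [anyR]
  | cons a l ih =>
    have h : anyR p (a :: l) = (p a || anyR p l) := by
      show (Bool.rec (anyR p l) true (p a) : Bool) = _
      cases p a <;> rfl
    rw [h]; simp [ih]

theorem notR_eq (b : Bool) : (Bool.rec true false b : Bool) = !b := by cases b <;> rfl

theorem impR_iff (a b : Bool) :
    (Bool.rec true b a : Bool) = true ↔ (a = true → b = true) := by cases a <;> simp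

theorem orR_iff (a b : Bool) :
    (Bool.rec b true a : Bool) = true ↔ (a = true ∨ b = true) := by cases a <;> simp

theorem mapR_eq {α β : Type} (f : α → β) (l : List α) : mapR f l = l.map f := by
  induction l with
  | nil => rfl
  | cons a l ih => show f a :: mapR f l = _; rw [ih]; rfl

theorem snocR_eq {α : Type} (l : List α) (x : α) : snocR l x = l ++ [x] := by
  induction l with
  | nil => rfl
  | cons a l ih => show a :: snocR l x = _; rw [ih]; rfl

theorem lin_nil (m : ℕ) : lin [] m = 0 := rfl

theorem lin_cons (p : ℕ) (P : List ℕ) (m : ℕ) :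
    lin (p :: P) m = ((m % 2) * p) ^^^ lin P (m / 2) := rfl

theorem leq_iff (l r : List ℕ) : leq l r = true ↔ l = r := by
  induction l generalizing r with
  | nil => cases r <;> simp [leq]
  | cons a l ih =>
    cases r with
    | nil => simp [leq]
    | cons b r =>
      have h : leq (a :: l) (b :: r) = (Nat.beq a b && leq l r) := by
        show (Bool.rec false (leq l r) (Nat.beq a b) : Bool) = _
        cases Nat.beq a b <;> rfl
      rw [h]; simp [ih]

theorem inSec_iff (l : List ℕ) (L : List (List ℕ)) :
    inSec l L = true ↔ l ∈ L.sections := by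
  rw [List.mem_sections]
  induction l generalizing L with
  | nil => cases L <;> simp [inSec]
  | cons a l ih =>
    cases L with
    | nil => simp [inSec]
    | cons b r =>
      have h : inSec (a :: l) (b :: r) = (anyR (Nat.beq a) b && inSec l r) := by
        show (Bool.rec false (inSec l r) (anyR (Nat.beq a) b) : Bool) = _
        cases anyR (Nat.beq a) b <;> rfl
      rw [h]; simp [ih, anyR_iff]

theorem getR_eq (l : List ℕ) (j : ℕ) : getR l j = l.getD j 0 := by
  induction l generalizing j with
  | nil => rfl
  | cons a l ih =>
    cases j with
    | zero => rfl
    | succ j => show getR l j = _; rw [ih]; rfl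

theorem val_true (B : List ℕ) (j : ℕ) : val B j true = 2 ^ j := rfl

theorem val_false (B : List ℕ) (j : ℕ) : val B j false = B.getD j 0 := getR_eq B j

theorem nonsing_iff (A l : List ℕ) :
    nonsing A l = true ↔ ∀ m ∈ l, m ≠ 0 → (lin A m) &&& m ≠ 0 := by
  unfold nonsing
  rw [allR_iff]
  refine forall₂_congr fun m _ => ?_
  rw [orR_iff, notR_eq]
  show _ ∨ (!(Nat.beq (lin A m &&& m) 0)) = true ↔ _
  rw [Bool.not_eq_true', ← Bool.not_eq_true, Nat.beq_eq, Nat.beq_eq]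
  tauto

/-! Coding of vectors. -/

def dec (n m : ℕ) : Fin n → ZMod 2 := fun i => if m.testBit i then 1 else 0

theorem dec_xor (n a b : ℕ) : dec n (a ^^^ b) = dec n a + dec n b := by
  funext i
  simp only [dec, Nat.testBit_xor, Pi.add_apply]
  cases a.testBit i <;> cases b.testBit i <;> decide

theorem dec_zero (n : ℕ) : dec n 0 = 0 := by
  funext i; simp [dec]

theorem dec_inj {n a b : ℕ} (ha : a < 2 ^ n) (hb : b < 2 ^ n) (h : dec n a = dec n b) : a = b := by
  apply Nat.eq_of_testBit_eq
  intro i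
  by_cases hi : i < n
  · have := congrFun h ⟨i, hi⟩
    simp only [dec] at this
    cases h1 : a.testBit i <;> cases h2 : b.testBit i <;> simp_all
  · have h2 : 2 ^ n ≤ 2 ^ i := Nat.pow_le_pow_right (by norm_num) (by omega)
    rw [Nat.testBit_lt_two_pow (by omega), Nat.testBit_lt_two_pow (by omega)]

theorem dec_surj (n : ℕ) (x : Fin n → ZMod 2) : ∃ m < 2 ^ n, dec n m = x := by
  have hinj : Function.Injective (fun m : Fin (2 ^ n) => dec n m) := by
    intro a b h
    exact Fin.ext (dec_inj a.2 b.2 h)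
  have hb : Function.Bijective (fun m : Fin (2 ^ n) => dec n m) := by
    rw [Fintype.bijective_iff_injective_and_card]
    refine ⟨hinj, by simp [ZMod.card]⟩
  obtain ⟨m, hm⟩ := hb.2 x
  exact ⟨m, m.2, hm⟩

theorem dec_two_pow (n : ℕ) (i : Fin n) : dec n (2 ^ (i : ℕ)) = Pi.single i 1 := by
  funext j
  simp only [dec, Nat.testBit_two_pow, Pi.single_apply]
  by_cases h : j = i
  · simp [h]
  · have : (i : ℕ) ≠ j := fun h' => h (Fin.ext h'.symm)
    simp [h, this]

theorem dec_lin (N : ℕ) {n : ℕ} (P : Fin n → ℕ) (m : ℕ) :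
    dec N (lin (List.ofFn P) m) = ∑ j, dec n m j • dec N (P j) := by
  induction n generalizing m with
  | zero => simp [lin_nil, dec_zero]
  | succ n ih =>
    rw [List.ofFn_succ, lin_cons, dec_xor, ih, Fin.sum_univ_succ]
    congr 1
    · rcases Nat.mod_two_eq_zero_or_one m with h | h
      · simp [h, dec, Nat.testBit_zero, dec_zero]
      · simp [h, dec, Nat.testBit_zero]
    · refine Finset.sum_congr rfl fun j _ => ?_
      congr 1
      simp [dec, Nat.testBit_succ]

theorem lin_lt (N : ℕ) (P : List ℕ) (hP : ∀ p ∈ P, p < 2 ^ N) (m : ℕ) : lin P m < 2 ^ N := by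
  induction P generalizing m with
  | nil => simp [lin_nil]
  | cons p P ih =>
    rw [lin_cons]
    apply Nat.xor_lt_two_pow
    · rcases Nat.mod_two_eq_zero_or_one m with h | h
      · simp [h]
      · simpa [h] using hP p (by simp)
    · exact ih (fun q hq => hP q (by simp [hq])) _

theorem lin_zero (P : List ℕ) : lin P 0 = 0 := by
  induction P with
  | nil => rfl
  | cons p P ih => rw [lin_cons]; simp [ih]

theorem lin_append (P P' : List ℕ) (m : ℕ) (hm : m < 2 ^ P.length) :
    lin (P ++ P') m = lin P m := by
  induction P generalizing m with
  | nil =>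
    have : m = 0 := by simpa using hm
    subst this
    rw [lin_zero, lin_zero]
  | cons p P ih =>
    rw [List.cons_append, lin_cons, lin_cons, ih]
    rw [List.length_cons, pow_succ] at hm
    omega

/-- The normalized coloring with matrix columns `A`. -/
noncomputable def col (n : ℕ) (A : List ℕ) : Fin n × Bool → (Fin n → ZMod 2) :=
  fun F => dec n (val A F.1 F.2)

theorem col_true (n : ℕ) (A : List ℕ) (i : Fin n) : col n A (i, true) = Pi.single i 1 := by
  simp only [col, val_true, dec_two_pow]

theorem col_false (n : ℕ) (A : List ℕ) (i : Fin n) :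
    col n A (i, false) = dec n (A.getD i 0) := by
  simp only [col, val_false]

theorem sum_single {n : ℕ} (w : Fin n → ZMod 2) :
    ∑ j, w j • (Pi.single j 1 : Fin n → ZMod 2) = w := by
  funext i
  simp [Finset.sum_apply, Pi.single_apply]

theorem ofFn_getD {n : ℕ} (A : List ℕ) (h : A.length = n) :
    List.ofFn (fun i : Fin n => A.getD i 0) = A := by
  subst h
  apply List.ext_getElem <;> simp

theorem two_zero (x : ZMod 2) : x + x = 0 := CharTwo.add_self_eq_zero x

theorem dec_lin_getD (n m : ℕ) (A : List ℕ) (hA : A.length = n) :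
    dec n (lin A m) = ∑ j : Fin n, dec n m j • dec n (A.getD j 0) := by
  conv_lhs => rw [← ofFn_getD A hA]
  rw [dec_lin]

theorem nonsing_of_cube (n : ℕ) (A : List ℕ) (hA : A.length = n)
    (h : CubeNonsingular n (col n A)) (m : ℕ) (hm : m < 2 ^ n) (hm0 : m ≠ 0) :
    (lin A m) &&& m ≠ 0 := by
  intro hz
  have hLI := h.2 (fun j => !(m.testBit j))
  rw [Fintype.linearIndependent_iff] at hLI
  set w := dec n (lin A m) with hw
  have hwm : ∀ j : Fin n, m.testBit j = true → w j = 0 := by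
    intro j hj
    have := congrArg (fun t => Nat.testBit t j) hz
    simp only [Nat.testBit_and, hj, Bool.and_true, Nat.zero_testBit] at this
    simp [hw, dec, this]
  have key := hLI (fun j => dec n m j + w j) (by
    have : ∀ j : Fin n, (dec n m j + w j) • col n A (j, !(m.testBit j)) =
        dec n m j • dec n (A.getD j 0) + w j • (Pi.single j 1 : Fin n → ZMod 2) := by
      intro j
      cases hj : m.testBit j
      · rw [Bool.not_false, col_true]
        simp [dec, hj]
      · rw [Bool.not_true, col_false, hwm j hj]
        simp
    rw [Finset.sum_congr rfl fun j _ => this j, Finset.sum_add_distrib, sum_single,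
      ← dec_lin_getD n m A hA, ← hw]
    funext i
    exact two_zero _)
  apply hm0
  apply dec_inj hm (by positivity)
  rw [dec_zero]
  funext j
  cases hj : m.testBit j
  · simp [dec, hj]
  · have := key j
    rw [hwm j hj, add_zero] at this
    exact this

theorem cube_of_nonsing (n : ℕ) (A : List ℕ) (hA : A.length = n)
    (h : ∀ m < 2 ^ n, m ≠ 0 → (lin A m) &&& m ≠ 0) : CubeNonsingular n (col n A) := by
  have hLI : ∀ v : Fin n → Bool, LinearIndependent (ZMod 2) (fun i => col n A (i, v i)) := by
    intro v
    rw [Fintype.linearIndependent_iff]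
    intro g hg
    obtain ⟨m, hm, hmg⟩ := dec_surj n (fun j => if v j then 0 else g j)
    set u : Fin n → ZMod 2 := fun j => if v j then g j else 0 with hu
    have hsplit : ∀ j, g j • col n A (j, v j) =
        dec n m j • dec n (A.getD j 0) + u j • (Pi.single j 1 : Fin n → ZMod 2) := by
      intro j
      rw [hmg, hu]
      cases hj : v j
      · rw [col_false]; simp [hj]
      · rw [col_true]; simp [hj]
    rw [Finset.sum_congr rfl fun j _ => hsplit j, Finset.sum_add_distrib, sum_single,
      ← dec_lin_getD n m A hA] at hg
    have hlu : dec n (lin A m) = u := by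
      funext j
      have := congrFun hg j
      simp only [Pi.add_apply, Pi.zero_apply] at this
      exact CharTwo.add_eq_zero.mp this
    have hm0 : m = 0 := by
      by_contra hne
      apply h m hm hne
      apply Nat.eq_of_testBit_eq
      intro i
      rw [Nat.testBit_and, Nat.zero_testBit]
      by_cases hi : i < n
      · cases hmi : m.testBit i
        · simp
        · have h1 := congrFun hmg ⟨i, hi⟩
          have h2 := congrFun hlu ⟨i, hi⟩
          simp only [dec, hmi, hu] at h1 h2
          cases hv : v ⟨i, hi⟩
          · cases hl : (lin A m).testBit i
            · rfl
            · simp [hv, hl] at h2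
          · simp [hv] at h1
      · have h2 : 2 ^ n ≤ 2 ^ i := Nat.pow_le_pow_right (by norm_num) (by omega)
        rw [Nat.testBit_lt_two_pow (x := m) (by omega), Bool.and_false]
    subst hm0
    rw [lin_zero, dec_zero] at hlu
    rw [dec_zero] at hmg
    intro i
    have h1 := congrFun hmg i
    have h2 := congrFun hlu i
    simp only [hu, Pi.zero_apply] at h1 h2
    cases hv : v i
    · simpa [hv] using h1.symm
    · simpa [hv] using h2.symm
  refine ⟨?_, hLI⟩
  rintro ⟨i, s⟩
  exact (hLI (fun _ => s)).ne_zero i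

/-! The equivalence relation. -/

def symPerm {n : ℕ} (σ : Equiv.Perm (Fin n)) (ε : Fin n → Bool) : Equiv.Perm (Fin n × Bool) where
  toFun F := (σ F.1, Bool.xor (ε F.1) F.2)
  invFun F := (σ.symm F.1, Bool.xor (ε (σ.symm F.1)) F.2)
  left_inv := by rintro ⟨i, s⟩; simp
  right_inv := by rintro ⟨i, s⟩; simp

theorem symPerm_mem {n : ℕ} (σ : Equiv.Perm (Fin n)) (ε : Fin n → Bool) :
    symPerm σ ε ∈ CubeSym n := ⟨σ, ε, fun _ _ => rfl⟩

theorem dj_refl {n : ℕ} (lam : Fin n × Bool → (Fin n → ZMod 2)) : CubeDJEquiv n lam lam :=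
  ⟨LinearEquiv.refl _ _, Equiv.refl _, ⟨Equiv.refl _, fun _ => false, by simp⟩, by simp⟩

theorem dj_symm {n : ℕ} {lam mu : Fin n × Bool → (Fin n → ZMod 2)}
    (h : CubeDJEquiv n lam mu) : CubeDJEquiv n mu lam := by
  obtain ⟨g, a, ⟨σ, ε, ha⟩, h⟩ := h
  refine ⟨g.symm, a.symm, ⟨σ.symm, fun i => ε (σ.symm i), ?_⟩, ?_⟩
  · intro i s
    rw [Equiv.symm_apply_eq, ha]
    simp
  · intro F
    rw [h]
    simp

theorem dj_trans {n : ℕ} {lam mu nu : Fin n × Bool → (Fin n → ZMod 2)}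
    (h : CubeDJEquiv n lam mu) (h' : CubeDJEquiv n mu nu) : CubeDJEquiv n lam nu := by
  obtain ⟨g, a, ⟨σ, ε, ha⟩, h⟩ := h
  obtain ⟨g', b, ⟨τ, δ, hb⟩, h'⟩ := h'
  refine ⟨g'.trans g, a.trans b, ⟨σ.trans τ, fun i => Bool.xor (δ (σ i)) (ε i), ?_⟩, ?_⟩
  · intro i s
    simp [ha, hb]
  · intro F
    rw [h, h']
    simp

theorem li_sym {n : ℕ} {mu : Fin n × Bool → (Fin n → ZMod 2)} (h : CubeNonsingular n mu)
    (σ : Equiv.Perm (Fin n)) (f : Fin n → Bool) :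
    LinearIndependent (ZMod 2) (fun i => mu (σ i, f i)) := by
  have := (h.2 (fun k => f (σ.symm k))).comp σ σ.injective
  simpa [Function.comp_def] using this

theorem nonsing_transport {n : ℕ} {lam mu : Fin n × Bool → (Fin n → ZMod 2)}
    (h : CubeDJEquiv n lam mu) (hmu : CubeNonsingular n mu) : CubeNonsingular n lam := by
  obtain ⟨g, a, ⟨σ, ε, ha⟩, h⟩ := h
  refine ⟨?_, ?_⟩
  · intro F hF
    rw [h, LinearEquiv.map_eq_zero_iff] at hF
    exact hmu.1 _ hF
  · intro v
    have h1 := li_sym hmu σ (fun i => Bool.xor (ε i) (v i))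
    have h2 := h1.map' g.toLinearMap g.ker
    have : (fun i => lam (i, v i)) =
        (g.toLinearMap ∘ fun i => mu (σ i, Bool.xor (ε i) (v i))) := by
      funext i
      rw [h, ha]
      rfl
    rw [this]
    exact h2

theorem dj_sound {n : ℕ} {mu : Fin n × Bool → (Fin n → ZMod 2)} (hmu : CubeNonsingular n mu)
    (A : List ℕ) (σ : Equiv.Perm (Fin n)) (ε : Fin n → Bool)
    (h : ∀ i, mu (σ i, ε i) = ∑ j, dec n (A.getD i 0) j • mu (σ j, !(ε j))) :
    CubeDJEquiv n (col n A) mu := by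
  have hli := li_sym hmu σ (fun j => !(ε j))
  have hsp := hli.span_eq_top_of_card_eq_finrank' (by simp)
  let b := Module.Basis.mk hli hsp.ge
  have hb : ∀ j, b.equivFun (mu (σ j, !(ε j))) = Pi.single j 1 := by
    intro j
    have : mu (σ j, !(ε j)) = b j := by simp [b]
    rw [this]
    funext i
    rw [b.equivFun_self]
    simp [Pi.single_apply, eq_comm]
  refine ⟨b.equivFun, symPerm σ ε, symPerm_mem σ ε, ?_⟩
  rintro ⟨i, s⟩
  cases s
  · have : symPerm σ ε (i, false) = (σ i, ε i) := by simp [symPerm]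
    rw [this, h, map_sum, col_false]
    simp only [map_smul, hb, sum_single]
  · have : symPerm σ ε (i, true) = (σ i, !(ε i)) := by simp [symPerm]
    rw [this, hb, col_true]

theorem dj_complete {n : ℕ} {mu : Fin n × Bool → (Fin n → ZMod 2)} (A : List ℕ)
    (h : CubeDJEquiv n (col n A) mu) : ∃ (σ : Equiv.Perm (Fin n)) (ε : Fin n → Bool),
      ∀ i, mu (σ i, ε i) = ∑ j, dec n (A.getD i 0) j • mu (σ j, !(ε j)) := by
  obtain ⟨g, a, ⟨σ, ε, ha⟩, h⟩ := h
  refine ⟨σ, ε, fun i => ?_⟩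
  have hf : ∀ i, g (mu (σ i, ε i)) = dec n (A.getD i 0) := by
    intro i
    rw [← col_false, h, ha]
    simp
  have ht : ∀ i, g (mu (σ i, !(ε i))) = Pi.single i 1 := by
    intro i
    rw [← col_true n A i, h, ha]
    simp
  apply g.injective
  rw [hf, map_sum]
  simp only [map_smul, ht, sum_single]

theorem exists_normal {n : ℕ} {mu : Fin n × Bool → (Fin n → ZMod 2)}
    (hmu : CubeNonsingular n mu) :
    ∃ A : List ℕ, A.length = n ∧ (∀ c ∈ A, c < 2 ^ n) ∧ CubeDJEquiv n (col n A) mu := by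
  have hli := hmu.2 (fun _ => true)
  have hsp := hli.span_eq_top_of_card_eq_finrank' (by simp)
  let b := Module.Basis.mk hli hsp.ge
  choose f hf1 hf2 using fun i : Fin n => dec_surj n (b.equivFun (mu (i, false)))
  refine ⟨List.ofFn f, by simp, ?_, ?_⟩
  · intro c hc
    rw [List.mem_ofFn] at hc
    obtain ⟨i, rfl⟩ := hc
    exact hf1 i
  · apply dj_sound hmu _ 1 (fun _ => false)
    intro i
    have h1 : (List.ofFn f).getD i 0 = f i := by simp
    rw [h1, hf2]
    have := b.sum_equivFun (mu (i, false))
    simp only [Equiv.Perm.one_apply, Bool.not_false]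
    refine this.symm.trans (Finset.sum_congr rfl fun j _ => ?_)
    congr 1
    simp [b]

/-! Coded symmetries. -/

def symL {n : ℕ} (σ : Equiv.Perm (Fin n)) (ε : Fin n → Bool) : List (ℕ × Bool) :=
  List.ofFn fun i => ((σ i : ℕ), ε i)

theorem valid_symL {n : ℕ} (σ : Equiv.Perm (Fin n)) (ε : Fin n → Bool) :
    valid n (symL σ ε) = true := by
  simp only [valid, symL, List.map_ofFn, Bool.and_eq_true, decide_eq_true_eq, List.all_eq_true,
    List.length_ofFn, List.nodup_ofFn, true_and]
  refine ⟨?_, ?_⟩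
  · intro i j hij
    exact σ.injective (Fin.ext hij)
  · intro x hx
    rw [List.mem_ofFn] at hx
    obtain ⟨i, rfl⟩ := hx
    exact (σ i).2

theorem exists_symL {n : ℕ} {a : List (ℕ × Bool)} (h : valid n a = true) :
    ∃ (σ : Equiv.Perm (Fin n)) (ε : Fin n → Bool), a = symL σ ε := by
  simp only [valid, Bool.and_eq_true, decide_eq_true_eq, List.all_eq_true] at h
  obtain ⟨rfl, hnd, hlt⟩ := h
  let f : Fin a.length → Fin a.length := fun i =>
    ⟨(a[i]).1, hlt _ (List.mem_map_of_mem (List.getElem_mem _))⟩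
  have hf : Function.Injective f := by
    intro i j hij
    have h1 : (a[i]).1 = (a[j]).1 := congrArg Fin.val hij
    have h2 := (List.Nodup.getElem_inj_iff hnd (i := i) (j := j)
      (hi := by simp) (hj := by simp)).mp (by simpa using h1)
    exact Fin.ext h2
  refine ⟨Equiv.ofBijective f (Finite.injective_iff_bijective.mp hf), fun i => (a[i]).2, ?_⟩
  unfold symL
  apply List.ext_getElem
  · simp
  · intro i h1 h2
    simp [f]

theorem pcol_symL {n : ℕ} (B : List ℕ) (σ : Equiv.Perm (Fin n)) (ε : Fin n → Bool) :
    pcol B (symL σ ε) = List.ofFn fun j => val B (σ j) (!(ε j)) := by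
  unfold pcol symL
  rw [mapR_eq, List.map_ofFn]
  congr 1
  funext j
  simp only [Function.comp_apply, notR_eq]

theorem qcol_symL {n : ℕ} (B : List ℕ) (σ : Equiv.Perm (Fin n)) (ε : Fin n → Bool) :
    qcol B (symL σ ε) = List.ofFn fun j => val B (σ j) (ε j) := by
  unfold qcol symL
  rw [mapR_eq, List.map_ofFn]
  rfl

theorem chk_symL {n : ℕ} (A B : List ℕ) (hA : A.length = n) (σ : Equiv.Perm (Fin n))
    (ε : Fin n → Bool) : chk A B (symL σ ε) = true ↔
      ∀ i : Fin n, lin (pcol B (symL σ ε)) (A.getD i 0) = val B (σ i) (ε i) := by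
  unfold chk
  rw [leq_iff, mapR_eq, qcol_symL]
  subst hA
  constructor
  · intro h i
    have h1 := congrArg (fun l => l.getD (i : ℕ) 0) h
    simpa using h1
  · intro h
    apply List.ext_getElem
    · simp
    · intro i h1 h2
      have hi : i < A.length := by simpa using h1
      have := h ⟨i, hi⟩
      simpa [hi] using this

theorem chk_sound {n : ℕ} {A B : List ℕ} (hA : A.length = n) {a : List (ℕ × Bool)}
    (hB : CubeNonsingular n (col n B)) (hv : valid n a = true) (hc : chk A B a = true) :
    CubeDJEquiv n (col n A) (col n B) := by
  obtain ⟨σ, ε, rfl⟩ := exists_symL hv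
  rw [chk_symL A B hA, pcol_symL] at hc
  apply dj_sound hB A σ ε
  intro i
  have := congrArg (dec n) (hc i)
  rw [dec_lin] at this
  exact this.symm

theorem chk_complete {n : ℕ} {A B : List ℕ} (hA : A.length = n) (hB : ∀ c ∈ B, c < 2 ^ n)
    (h : CubeDJEquiv n (col n A) (col n B)) :
    ∃ (σ : Equiv.Perm (Fin n)) (ε : Fin n → Bool), chk A B (symL σ ε) = true := by
  obtain ⟨σ, ε, h⟩ := dj_complete A h
  refine ⟨σ, ε, ?_⟩
  have hval : ∀ (j : Fin n) s, val B j s < 2 ^ n := by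
    intro j s
    cases s
    · rw [val_false]
      by_cases hj : (j : ℕ) < B.length
      · rw [List.getD_eq_getElem _ _ hj]
        exact hB _ (List.getElem_mem _)
      · rw [List.getD_eq_default _ _ (by omega)]
        positivity
    · rw [val_true]
      exact Nat.pow_lt_pow_right (by norm_num) j.2
  rw [chk_symL A B hA, pcol_symL]
  intro i
  apply dec_inj (n := n) _ (hval _ _)
  · rw [dec_lin]
    exact (h i).symm
  · apply lin_lt
    intro p hp
    rw [List.mem_ofFn] at hp
    obtain ⟨j, rfl⟩ := hp
    exact hval _ _

theorem mem_tri {n : ℕ} {A : List ℕ} (h : A ∈ (tri n).sections) :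
    A.length = n ∧ (∀ k (hk : k < A.length), A[k] < 2 ^ (k + 1)) := by
  rw [List.mem_sections, List.forall₂_iff_get] at h
  obtain ⟨h1, h2⟩ := h
  have hl : A.length = n := by simpa [tri] using h1
  refine ⟨hl, fun k hk => ?_⟩
  have := h2 k hk (by omega)
  simp only [tri, List.get_eq_getElem, List.getElem_map, List.getElem_range,
    List.mem_range'_1] at this
  rw [pow_succ]
  omega

theorem mem_tri_lt {n : ℕ} {A : List ℕ} (h : A ∈ (tri n).sections) : ∀ c ∈ A, c < 2 ^ n := by
  obtain ⟨h1, h2⟩ := mem_tri h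
  intro c hc
  obtain ⟨k, hk, rfl⟩ := List.getElem_of_mem hc
  exact (h2 k hk).trans_le (Nat.pow_le_pow_right (by norm_num) (by omega))

theorem dfs2_cons (n : ℕ) (A B : List ℕ) (ch : List (ℕ × Bool)) (c : ℕ) (C : List ℕ)
    (acc : List (ℕ × Bool)) : dfs2 n A B ch (c :: C) acc = true ↔
      ∃ q ∈ ch, (∀ q' ∈ acc, q'.1 ≠ q.1) ∧ lin (pcol B (acc ++ [q])) c = val B q.1 q.2 ∧
        dfs2 n A B ch C (acc ++ [q]) = true := by
  show anyR (fun q =>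
      andR (allR (fun q' => Bool.rec true false (Nat.beq q'.1 q.1)) acc)
        (andR (Nat.beq (lin (pcol B (snocR acc q)) c) (val B q.1 q.2))
          (dfs2 n A B ch C (snocR acc q)))) ch = true ↔ _
  rw [anyR_iff]
  refine exists_congr fun q => and_congr_right fun _ => ?_
  rw [andR_eq, andR_eq, Bool.and_eq_true, Bool.and_eq_true, allR_iff, Nat.beq_eq, snocR_eq]
  refine and_congr_left fun _ => forall₂_congr fun q' _ => ?_
  rw [notR_eq, Bool.not_eq_true', ← Bool.not_eq_true, Nat.beq_eq]

theorem dfs2_nil (n : ℕ) (A B : List ℕ) (ch : List (ℕ × Bool)) (acc : List (ℕ × Bool)) :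
    dfs2 n A B ch [] acc = true ↔ valid n acc = true ∧ chk A B acc = true := by
  show andR (valid n acc) (chk A B acc) = true ↔ _
  rw [andR_eq, Bool.and_eq_true]

theorem dfs2_sound (n : ℕ) (A B : List ℕ) (ch : List (ℕ × Bool)) (C : List ℕ)
    (acc : List (ℕ × Bool)) (h : dfs2 n A B ch C acc = true) :
    ∃ a, valid n a = true ∧ chk A B a = true := by
  induction C generalizing acc with
  | nil => exact ⟨acc, (dfs2_nil ..).mp h⟩
  | cons c C ih =>
    obtain ⟨q, _, _, _, h⟩ := (dfs2_cons ..).mp h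
    exact ih _ h

theorem dfs2_complete {n : ℕ} {A B : List ℕ} {ch : List (ℕ × Bool)}
    (hch : ∀ j < n, ∀ s, (j, s) ∈ ch) (hA : A ∈ (tri n).sections)
    (σ : Equiv.Perm (Fin n)) (ε : Fin n → Bool) (hc : chk A B (symL σ ε) = true)
    (C : List ℕ) (k : ℕ) (hC : C = A.drop k) :
    dfs2 n A B ch C ((symL σ ε).take k) = true := by
  obtain ⟨hl, hlt⟩ := mem_tri hA
  have hlen : (symL σ ε).length = n := by simp [symL]
  induction C generalizing k with
  | nil =>
    have : A.length ≤ k := List.drop_eq_nil_iff.mp hC.symm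
    rw [List.take_of_length_le (by omega), dfs2_nil]
    exact ⟨valid_symL σ ε, hc⟩
  | cons c C ih =>
    have hk : k < A.length := by
      by_contra hk
      rw [List.drop_of_length_le (by omega)] at hC
      cases hC
    rw [List.drop_eq_getElem_cons hk] at hC
    injection hC with hc1 hC1
    have hkn : k < n := by omega
    have htake : (symL σ ε).take k ++ [((σ ⟨k, hkn⟩ : ℕ), ε ⟨k, hkn⟩)] =
        (symL σ ε).take (k + 1) := by
      rw [List.take_add_one]
      congr 1
      simp [symL, hkn]
    rw [dfs2_cons]
    refine ⟨((σ ⟨k, hkn⟩ : ℕ), ε ⟨k, hkn⟩), hch _ (σ ⟨k, hkn⟩).2 _, ?_, ?_, ?_⟩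
    · intro q hq hqe
      obtain ⟨i, hi, rfl⟩ := List.getElem_of_mem hq
      have hik : i < k := by
        have := hi
        rw [List.length_take] at this
        omega
      have hin : i < n := by omega
      simp only [List.getElem_take, symL, List.getElem_ofFn] at hqe
      have := σ.injective (Fin.ext hqe)
      simp at this
      omega
    · rw [htake]
      have h1 := (chk_symL A B hl σ ε).mp hc ⟨k, hkn⟩
      rw [← h1, List.getD_eq_getElem _ _ hk]
      have h2 : pcol B (symL σ ε) =
          pcol B ((symL σ ε).take (k + 1)) ++ pcol B ((symL σ ε).drop (k + 1)) := by
        unfold pcol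
        simp only [mapR_eq]
        rw [← List.map_append, List.take_append_drop]
      rw [h2, lin_append]
      · rw [hc1]
      · have : (pcol B ((symL σ ε).take (k + 1))).length = k + 1 := by
          unfold pcol
          rw [mapR_eq, List.length_map, List.length_take]
          omega
        rw [this]
        exact hlt k hk
    · rw [htake]
      exact ih (k + 1) hC1

theorem iso_sound {n : ℕ} {ch : List (ℕ × Bool)} {A B : List ℕ} (hA : A.length = n)
    (hB : CubeNonsingular n (col n B)) (h : iso n ch A B = true) :
    CubeDJEquiv n (col n A) (col n B) := by
  obtain ⟨a, h1, h2⟩ := dfs2_sound _ _ _ _ _ _ h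
  exact chk_sound hA hB h1 h2

theorem iso_complete {n : ℕ} {ch : List (ℕ × Bool)} {A B : List ℕ}
    (hch : ∀ j < n, ∀ s, (j, s) ∈ ch) (hA : A ∈ (tri n).sections) (hB : B ∈ (tri n).sections)
    (h : CubeDJEquiv n (col n A) (col n B)) : iso n ch A B = true := by
  obtain ⟨σ, ε, hc⟩ := chk_complete (mem_tri hA).1 (mem_tri_lt hB) h
  exact dfs2_complete hch hA σ ε hc A 0 rfl

theorem dfs1_leaf {n : ℕ} {A : List ℕ} (hl : A.length = n) (hlt : ∀ c ∈ A, c < 2 ^ n)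
    (hns : ∀ m < 2 ^ n, m ≠ 0 → (lin A m) &&& m ≠ 0) (r k : ℕ) (hk : k + r = n)
    (h : dfs1 n (List.range' k r) (A.take k) = true) : leaf1 n A = true := by
  induction r generalizing k with
  | zero =>
    have h' : leaf1 n (A.take k) = true := h
    rwa [List.take_of_length_le (by omega)] at h'
  | succ r ih =>
    have h' : allR (fun c => Bool.rec true (dfs1 n (List.range' (k + 1) r) (snocR (A.take k) c))
      (nonsing (snocR (A.take k) c) (List.range (2 ^ (k + 1))))) (List.range (2 ^ n)) = true := h
    rw [allR_iff] at h'
    have hkA : k < A.length := by omega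
    have h1 := h' A[k] (List.mem_range.mpr (hlt _ (List.getElem_mem _)))
    rw [impR_iff, snocR_eq, List.take_concat_get' A k hkA] at h1
    apply ih (k + 1) (by omega)
    apply h1
    rw [nonsing_iff]
    intro m hm hm0
    rw [List.mem_range] at hm
    have h2 : lin A m = lin (A.take (k + 1)) m := by
      conv_lhs => rw [← List.take_append_drop (k + 1) A]
      apply lin_append
      rw [List.length_take]
      rwa [Nat.min_eq_left (by omega)]
    rw [← h2]
    exact hns m (hm.trans_le (Nat.pow_le_pow_right (by norm_num) (by omega))) hm0

theorem leaf1_sound {n : ℕ} {A : List ℕ} (hA : CubeNonsingular n (col n A))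
    (h : leaf1 n A = true) :
    ∃ T ∈ (tri n).sections, CubeDJEquiv n (col n T) (col n A) := by
  unfold leaf1 at h
  rw [anyR_iff] at h
  obtain ⟨l, _, h⟩ := h
  rw [andR_eq, andR_eq, Bool.and_eq_true, Bool.and_eq_true, inSec_iff] at h
  obtain ⟨h1, h2, h3⟩ := h
  exact ⟨_, h1, chk_sound (mem_tri h1).1 hA h2 h3⟩

theorem pw_pairwise {n : ℕ} {ch : List (ℕ × Bool)} {R : List (List ℕ)} (h : pw n ch R = true) :
    R.Pairwise fun A B => ¬ iso n ch A B = true := by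
  induction R with
  | nil => simp
  | cons A R ih =>
    have h' : andR (allR (fun B => Bool.rec true false (iso n ch A B)) R) (pw n ch R) = true := h
    rw [andR_eq, Bool.and_eq_true, allR_iff] at h'
    rw [List.pairwise_cons]
    refine ⟨fun B hB => ?_, ih h'.2⟩
    have := h'.1 B hB
    rw [notR_eq] at this
    simpa using this

theorem count {n : ℕ} {ch : List (ℕ × Bool)} {R : List (List ℕ)}
    (hch : ∀ j < n, ∀ s, (j, s) ∈ ch) (hgood : good n R = true) (hpw : pw n ch R = true)
    (hs1 : dfs1 n (List.range n) [] = true) (hs2 : stage2 n ch R = true) :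
    Nat.card (Quot (fun lam mu :
        {l : Fin n × Bool → (Fin n → ZMod 2) // CubeNonsingular n l} =>
      CubeDJEquiv n lam.1 mu.1)) = R.length := by
  have hR : ∀ A ∈ R, A ∈ (tri n).sections ∧ CubeNonsingular n (col n A) := by
    unfold good at hgood
    rw [allR_iff] at hgood
    intro A hA
    have h := hgood A hA
    rw [andR_eq, Bool.and_eq_true, inSec_iff, nonsing_iff] at h
    refine ⟨h.1, cube_of_nonsing n A (mem_tri h.1).1 fun m hm => h.2 m (List.mem_range.mpr hm)⟩
  have hcover : ∀ mu, CubeNonsingular n mu → ∃ B ∈ R, CubeDJEquiv n (col n B) mu := by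
    intro mu hmu
    obtain ⟨A, hl, hlt, hA⟩ := exists_normal hmu
    have hAn := nonsing_transport hA hmu
    have hleaf : leaf1 n A = true := by
      apply dfs1_leaf hl hlt (nonsing_of_cube n A hl hAn) n 0 (by omega)
      rw [← List.range_eq_range']
      exact hs1
    obtain ⟨T, hT, hTA⟩ := leaf1_sound hAn hleaf
    unfold stage2 at hs2
    rw [allR_iff] at hs2
    have h2 := hs2 T hT
    rw [anyR_iff] at h2
    obtain ⟨B, hB, hi⟩ := h2
    have hTB := iso_sound (mem_tri hT).1 (hR B hB).2 hi
    exact ⟨B, hB, dj_trans (dj_symm hTB) (dj_trans hTA hA)⟩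
  let f : Fin R.length → Quot (fun lam mu :
        {l : Fin n × Bool → (Fin n → ZMod 2) // CubeNonsingular n l} =>
      CubeDJEquiv n lam.1 mu.1) :=
    fun k => Quot.mk _ ⟨col n R[k], (hR _ (List.getElem_mem _)).2⟩
  have hbij : Function.Bijective f := by
    refine ⟨?_, ?_⟩
    · have hne : ∀ i j : Fin R.length, i < j → f i ≠ f j := by
        intro i j hij hf
        have heq : Equivalence (fun lam mu :
            {l : Fin n × Bool → (Fin n → ZMod 2) // CubeNonsingular n l} =>
            CubeDJEquiv n lam.1 mu.1) :=
          ⟨fun _ => dj_refl _, fun h => dj_symm h, fun h h' => dj_trans h h'⟩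
        have hd : CubeDJEquiv n (col n R[i]) (col n R[j]) := by
          have := Quot.eqvGen_exact hf
          rwa [heq.eqvGen_iff] at this
        have hp := List.pairwise_iff_getElem.mp (pw_pairwise hpw) i j i.2 j.2 hij
        exact hp (iso_complete hch (hR _ (List.getElem_mem _)).1 (hR _ (List.getElem_mem _)).1 hd)
      intro i j hf
      rcases lt_trichotomy i j with h | h | h
      · exact absurd hf (hne i j h)
      · exact h
      · exact absurd hf.symm (hne j i h)
    · intro x
      induction x using Quot.ind with
      | mk mu =>
        obtain ⟨B, hB, h⟩ := hcover mu.1 mu.2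
        obtain ⟨k, hk, rfl⟩ := List.getElem_of_mem hB
        exact ⟨⟨k, hk⟩, Quot.sound h⟩
  rw [← Nat.card_eq_of_bijective f hbij, Nat.card_fin]

def R2 : List (List ℕ) := [[1, 2], [1, 3]]

def R3 : List (List ℕ) := [[1, 2, 4], [1, 2, 5], [1, 2, 7], [1, 3, 5], [1, 3, 6]]

def R4 : List (List ℕ) :=
  [[1, 2, 4, 8], [1, 2, 4, 9], [1, 2, 4, 11], [1, 2, 4, 15], [1, 2, 5, 9], [1, 2, 5, 10],
   [1, 2, 5, 11], [1, 2, 5, 12], [1, 2, 5, 14], [1, 2, 7, 11], [1, 2, 7, 12], [1, 2, 7, 13],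
   [1, 3, 5, 9], [1, 3, 5, 10], [1, 3, 5, 14], [1, 3, 6, 10], [1, 3, 6, 11], [1, 3, 6, 12],
   [1, 3, 6, 13]]

def ch2 : List (ℕ × Bool) := [(0, false), (0, true), (1, false), (1, true)]

def ch3 : List (ℕ × Bool) :=
  [(0, false), (0, true), (1, false), (1, true), (2, false), (2, true)]

def ch4 : List (ℕ × Bool) :=
  [(0, false), (0, true), (1, false), (1, true), (2, false), (2, true), (3, false), (3, true)]

theorem good2 : good 2 R2 = true := by decide +kernel
theorem good3 : good 3 R3 = true := by decide +kernel
theorem good4 : good 4 R4 = true := by decide +kernel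
theorem stage2_2 : stage2 2 ch2 R2 = true := by decide +kernel
theorem stage2_3 : stage2 3 ch3 R3 = true := by decide +kernel
theorem stage2_4 : stage2 4 ch4 R4 = true := by decide +kernel
theorem pw2 : pw 2 ch2 R2 = true := by decide +kernel
theorem pw3 : pw 3 ch3 R3 = true := by decide +kernel
theorem pw4 : pw 4 ch4 R4 = true := by decide +kernel
theorem stage1_2 : dfs1 2 (List.range 2) [] = true := by decide +kernel
theorem stage1_3 : dfs1 3 (List.range 3) [] = true := by decide +kernel
theorem stage1_4 : dfs1 4 (List.range 4) [] = true := by decide +kernel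

end CubeDJ

/-- The numbers of DJ-equivalence classes of nonsingular colorings of the
`n`-cube for `n = 2, 3, 4` are `2`, `5`, `19`. -/
theorem cube_DJ_classes_count :
    Nat.card (Quot (fun lam mu :
        {l : Fin 2 × Bool → (Fin 2 → ZMod 2) // CubeNonsingular 2 l} =>
      CubeDJEquiv 2 lam.1 mu.1)) = 2 ∧
    Nat.card (Quot (fun lam mu :
        {l : Fin 3 × Bool → (Fin 3 → ZMod 2) // CubeNonsingular 3 l} =>
      CubeDJEquiv 3 lam.1 mu.1)) = 5 ∧
    Nat.card (Quot (fun lam mu :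
        {l : Fin 4 × Bool → (Fin 4 → ZMod 2) // CubeNonsingular 4 l} =>
      CubeDJEquiv 4 lam.1 mu.1)) = 19 := by
  exact ⟨CubeDJ.count (ch := CubeDJ.ch2) (R := CubeDJ.R2) (by decide) CubeDJ.good2 CubeDJ.pw2
      CubeDJ.stage1_2 CubeDJ.stage2_2,
    CubeDJ.count (ch := CubeDJ.ch3) (R := CubeDJ.R3) (by decide) CubeDJ.good3 CubeDJ.pw3
      CubeDJ.stage1_3 CubeDJ.stage2_3,
    CubeDJ.count (ch := CubeDJ.ch4) (R := CubeDJ.R4) (by decide) CubeDJ.good4 CubeDJ.pw4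
      CubeDJ.stage1_4 CubeDJ.stage2_4⟩
end
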